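/- Any cyclic right polygonal slope list whose positive turning T satisfies T ≥ 2π can be realized by an embedded right polygonal loop with folds in ℝ². -/

import Mathlib

/-- A slope: a rational number, or `∞` (encoded by `none`). -/
abbrev Slope := Option ℚ

/-- The primitive integral vector `(n, m)` associated to the slope `m/n`
(in lowest terms), with `(0, 1)` for slope `∞`. -/
def primVec : Slope → ℤ × ℤ
  | none => (0, 1)
  | some q => ((q.den : ℤ), q.num)

/-- The primitive integral vector of a slope, viewed in the plane. -/
noncomputable def primVecR (s : Slope) : ℝ × ℝ :=
  (((primVec s).1 : ℝ), ((primVec s).2 : ℝ))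

/-- Cross product (determinant) of two plane vectors. -/
def cross (u v : ℝ × ℝ) : ℝ := u.1 * v.2 - u.2 * v.1

/-- Dot product of two plane vectors. -/
def dotp (u v : ℝ × ℝ) : ℝ := u.1 * v.1 + u.2 * v.2

/-- The determinant of the primitive integral vectors of two slopes. -/
def primDet (s s' : Slope) : ℤ :=
  (primVec s).1 * (primVec s').2 - (primVec s).2 * (primVec s').1

/-- Euclidean norm of a plane vector. -/
noncomputable def vnorm (u : ℝ × ℝ) : ℝ := Real.sqrt (u.1 ^ 2 + u.2 ^ 2)

/-- The counterclockwise angle from `u` to `w`; when `cross u w > 0` (as at the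
vertices of a right polygonal path) this is the counterclockwise turning angle,
lying in `(0, π)`. -/
noncomputable def turnAngle (u w : ℝ × ℝ) : ℝ :=
  Real.arccos (dotp u w / (vnorm u * vnorm w))

/-- The angle in `[0, π)` of the line through the origin with slope `s`
(with `θ(∞) = π/2`). -/
noncomputable def slopeAngle : Slope → ℝ
  | none => Real.pi / 2
  | some q => if 0 ≤ q then Real.arctan (q : ℝ) else Real.arctan (q : ℝ) + Real.pi

/-- The positive angle `α(s,s')` from slope `s` to slope `s'`: the unique element of
`[0, π)` congruent to `θ(s') − θ(s)` modulo `π`. -/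
noncomputable def posAngle (s s' : Slope) : ℝ :=
  if slopeAngle s' - slopeAngle s < 0 then slopeAngle s' - slopeAngle s + Real.pi
  else slopeAngle s' - slopeAngle s

/-- The positive turning `T = Σ α(sᵢ, sᵢ₊₁)` (indices mod `k`) of the cyclic slope
list `s 0, …, s (k-1)`. -/
noncomputable def posTurning (k : ℕ) (s : ℕ → Slope) : ℝ :=
  ∑ j ∈ Finset.range k, posAngle (s j) (s ((j + 1) % k))

/-- The data of a continuous piecewise-linear path `γ : [0,k] → ℝ²` with `k` edges
(the `j`-th edge, `0 ≤ j < k`, being the image of `[j, j+1]`), subdivided into `m`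
nonconstant affine pieces with breakpoints `t 0 < t 1 < ⋯ < t m`, where
`t 0 = 0`, `t m = k`, every integer time `j ≤ k` is the breakpoint of index `vi j`,
and `γ` is affine on each `[t i, t (i+1)]`. -/
structure PLPathData where
  /-- the number of edges -/
  k : ℕ
  kpos : 0 < k
  /-- the path -/
  γ : ℝ → ℝ × ℝ
  /-- the number of affine pieces -/
  m : ℕ
  /-- the breakpoints -/
  t : ℕ → ℝ
  /-- `vi j` is the index of the breakpoint at integer time `j` -/
  vi : ℕ → ℕ
  t_mono : ∀ i < m, t i < t (i + 1)
  t_first : t 0 = 0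
  t_last : t m = (k : ℝ)
  vi_le : ∀ j ≤ k, vi j ≤ m
  vi_t : ∀ j ≤ k, t (vi j) = (j : ℝ)
  affine : ∀ i < m, ∀ x ∈ Set.Icc (t i) (t (i + 1)),
    γ x = γ (t i) + ((x - t i) / (t (i + 1) - t i)) • (γ (t (i + 1)) - γ (t i))
  nonconst : ∀ i < m, γ (t (i + 1)) ≠ γ (t i)

namespace PLPathData

variable (P : PLPathData)

/-- The direction of motion along the `i`-th affine piece. -/
noncomputable def dir (i : ℕ) : ℝ × ℝ := P.γ (P.t (i + 1)) - P.γ (P.t i)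

/-- The breakpoint of index `i` is a fold: it is interior, does not occur at an
integer time (i.e. is not a vertex time), and the direction of motion reverses
there. -/
def IsFold (i : ℕ) : Prop :=
  0 < i ∧ i < P.m ∧ (∀ j : ℕ, j ≤ P.k → P.t i ≠ (j : ℝ)) ∧
    dotp (P.dir (i - 1)) (P.dir i) < 0

/-- The number of fold points of the path. -/
noncomputable def foldCount : ℕ := {i | P.IsFold i}.ncard

/-- The `j`-th edge, as a subset of the plane. -/
def edge (j : ℕ) : Set (ℝ × ℝ) := P.γ '' Set.Icc (j : ℝ) ((j : ℝ) + 1)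

/-- The path realizes the slope list `s 0, …, s (k-1)`: for each `j < k` the `j`-th
edge is contained in a line of slope `s j`, and consecutive edges have distinct
slopes. -/
def Realizes (s : ℕ → Slope) : Prop :=
  (∀ j < P.k, ∀ x ∈ Set.Icc (j : ℝ) ((j : ℝ) + 1),
    cross (P.γ x - P.γ (j : ℝ)) (primVecR (s j)) = 0) ∧
  (∀ j, j + 1 < P.k → s j ≠ s (j + 1))

/-- The path (realizing the slope list `s`) is right polygonal: no fold point occurs
at (a neighborhood of) a vertex, and at each interior vertex the primitive integral
vectors `v, v'` in the incoming and outgoing directions satisfy `det (v, v') = 1`;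
equivalently, `|det (primVec (s (j-1)), primVec (s j))| = 1` and the incoming and
outgoing directions of motion have positive cross product. -/
def RightPolygonalPathFor (s : ℕ → Slope) : Prop :=
  (∀ i, P.IsFold i → ∀ j : ℕ, j ≤ P.k → P.γ (P.t i) ≠ P.γ (j : ℝ)) ∧
  ∀ j, 1 ≤ j → j < P.k →
    (primDet (s (j - 1)) (s j)).natAbs = 1 ∧
    0 < cross (P.dir (P.vi j - 1)) (P.dir (P.vi j))

/-- The path is a loop: its endpoints coincide. -/
def IsLoop : Prop := P.γ ((P.k : ℝ)) = P.γ 0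

/-- The loop (realizing the cyclic slope list `s`) is right polygonal: it closes up,
no fold point occurs at (a neighborhood of) a vertex, and at each vertex
(cyclically) the primitive integral vectors `v, v'` in the incoming and outgoing
directions satisfy `det (v, v') = 1`. -/
def RightPolygonalLoopFor (s : ℕ → Slope) : Prop :=
  P.IsLoop ∧
  (∀ i, P.IsFold i → ∀ j : ℕ, j ≤ P.k → P.γ (P.t i) ≠ P.γ (j : ℝ)) ∧
  ∀ j, 1 ≤ j → j ≤ P.k →
    (primDet (s (j - 1)) (s (j % P.k))).natAbs = 1 ∧
    0 < cross (P.dir (P.vi j - 1)) (P.dir (P.vi (j % P.k)))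

/-- The path is embedded: distinct edges meet only if consecutive, and then only at
their common vertex, and no point of the plane is traversed three or more times. -/
def EmbeddedPath : Prop :=
  (∀ j j', j + 1 < j' → j' < P.k → P.edge j ∩ P.edge j' = ∅) ∧
  (∀ j, j + 1 < P.k → P.edge j ∩ P.edge (j + 1) = {P.γ ((j : ℝ) + 1)}) ∧
  ∀ x₁ x₂ x₃, x₁ ∈ Set.Icc (0 : ℝ) (P.k : ℝ) → x₂ ∈ Set.Icc (0 : ℝ) (P.k : ℝ) →
    x₃ ∈ Set.Icc (0 : ℝ) (P.k : ℝ) → x₁ < x₂ → x₂ < x₃ →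
    ¬(P.γ x₁ = P.γ x₂ ∧ P.γ x₂ = P.γ x₃)

/-- The loop is embedded: distinct edges meet only if cyclically consecutive, and
then only at their common vertex (vertices, if `k = 2`), and no point of the plane is
traversed three or more times. -/
def EmbeddedLoop : Prop :=
  (∀ j j', j < j' → j' < P.k → j' ≠ j + 1 → ¬(j = 0 ∧ j' + 1 = P.k) →
    P.edge j ∩ P.edge j' = ∅) ∧
  (∀ j, j + 1 < P.k → ¬(j = 0 ∧ j + 2 = P.k) →
    P.edge j ∩ P.edge (j + 1) = {P.γ ((j : ℝ) + 1)}) ∧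
  (2 < P.k → P.edge 0 ∩ P.edge (P.k - 1) = {P.γ 0}) ∧
  (P.k = 2 → P.edge 0 ∩ P.edge 1 = {P.γ 0, P.γ 1}) ∧
  ∀ x₁ x₂ x₃, x₁ ∈ Set.Ico (0 : ℝ) (P.k : ℝ) → x₂ ∈ Set.Ico (0 : ℝ) (P.k : ℝ) →
    x₃ ∈ Set.Ico (0 : ℝ) (P.k : ℝ) → x₁ < x₂ → x₂ < x₃ →
    ¬(P.γ x₁ = P.γ x₂ ∧ P.γ x₂ = P.γ x₃)

/-- The total turning of a (right polygonal) loop with folds: the sum over the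
vertices `j = 1, …, k` (the vertex `k` being the initial vertex) of the
counterclockwise angle from the incoming direction to the outgoing direction,
plus `−π` for each fold point. -/
noncomputable def totalTurning : ℝ :=
  (∑ j ∈ Finset.Icc 1 P.k, turnAngle (P.dir (P.vi j - 1)) (P.dir (P.vi (j % P.k))))
    - (P.foldCount : ℝ) * Real.pi

end PLPathData

/-! ### Slopes in sheared coordinates -/

/-- The abscissa of the vector parallel to a slope whose ordinate is `1`, in the coordinates
`(X, Y)` of the plane for which `(X, Y)` stands for the point `(X, Y - ε X)`. -/
noncomputable def shearedSlope (ε : ℝ) : Slope → ℝ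
  | none => 0
  | some q => 1 / ((q : ℝ) + ε)

/-- The shear `ε` is so small that no slope oriented upwards becomes horizontal. -/
def ShearAdmissible (ε : ℝ) (s : Slope) : Prop :=
  ∀ q : ℚ, s = some q → q < 0 → (q : ℝ) + ε < 0

theorem exists_shearAdmissible (k : ℕ) (s : ℕ → Slope) :
    ∃ ε : ℝ, 0 < ε ∧ ∀ j < k, ShearAdmissible ε (s j) := by
  induction k with
  | zero => exact ⟨1, one_pos, by simp⟩
  | succ k ih =>
    obtain ⟨ε, hε, h⟩ := ih
    obtain ⟨ε', hε', h'⟩ : ∃ ε' : ℝ, 0 < ε' ∧ ShearAdmissible ε' (s k) := by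
      rcases hs : s k with _ | q
      · exact ⟨1, one_pos, by simp [ShearAdmissible]⟩
      · rcases lt_or_ge q 0 with hq | hq
        · have hq' : (q : ℝ) < 0 := by exact_mod_cast hq
          refine ⟨-q / 2, by linarith, ?_⟩
          rintro _ ⟨⟩ _
          linarith
        · refine ⟨1, one_pos, ?_⟩
          rintro _ ⟨⟩ h
          exact absurd h (not_lt.mpr hq)
    refine ⟨min ε ε', lt_min hε hε', fun j hj q hq hneg => ?_⟩
    rcases Nat.lt_succ_iff_lt_or_eq.mp hj with hj | rfl
    · linarith [h j hj q hq hneg, min_le_left ε ε']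
    · linarith [h' q hq hneg, min_le_right ε ε']

theorem ShearAdmissible.add_ne_zero {ε : ℝ} {q : ℚ} (hε : 0 < ε)
    (h : ShearAdmissible ε (some q)) : (q : ℝ) + ε ≠ 0 := by
  rcases lt_or_ge q 0 with hq | hq
  · exact (h q rfl hq).ne
  · have : (0 : ℝ) ≤ q := by exact_mod_cast hq
    positivity

theorem cross_shearedSlope_primVecR {ε : ℝ} {s : Slope} (hε : 0 < ε)
    (h : ShearAdmissible ε s) :
    cross (shearedSlope ε s, 1 - ε * shearedSlope ε s) (primVecR s) = 0 := by
  rcases s with _ | q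
  · simp [cross, shearedSlope, primVecR, primVec]
  · have h1 := h.add_ne_zero hε
    have h2 : (q.den : ℝ) ≠ 0 := by exact_mod_cast q.den_ne_zero
    have h3 : (q.num : ℝ) = q * q.den := by exact_mod_cast (Rat.mul_den_eq_num q).symm
    simp only [cross, shearedSlope, primVecR, primVec, Int.cast_natCast, h3]
    field_simp
    ring

theorem shearedSlope_injOn {ε : ℝ} {s s' : Slope} (hε : 0 < ε) (h : ShearAdmissible ε s)
    (h' : ShearAdmissible ε s') (heq : shearedSlope ε s = shearedSlope ε s') : s = s' := by
  rcases s with _ | q <;> rcases s' with _ | q'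
  · rfl
  · have := h'.add_ne_zero hε
    simp_all [shearedSlope]
  · have := h.add_ne_zero hε
    simp_all [shearedSlope]
  · simp only [shearedSlope, one_div, inv_inj, add_left_inj, Rat.cast_inj] at heq
    rw [heq]

theorem shearedSlope_lt_of_slopeAngle_lt {ε : ℝ} {s s' : Slope} (hε : 0 < ε)
    (h : ShearAdmissible ε s) (h' : ShearAdmissible ε s')
    (hlt : slopeAngle s' < slopeAngle s) : shearedSlope ε s < shearedSlope ε s' := by
  have hpos : ∀ q : ℚ, 0 ≤ q → 0 < (q : ℝ) + ε := fun q hq => by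
    have : (0 : ℝ) ≤ q := by exact_mod_cast hq
    positivity
  have hub := fun q : ℚ => Real.arctan_lt_pi_div_two (q : ℝ)
  have hlb := fun q : ℚ => Real.neg_pi_div_two_lt_arctan (q : ℝ)
  rcases s with _ | q <;> rcases s' with _ | q'
  · exact absurd hlt (lt_irrefl _)
  · simp only [slopeAngle] at hlt
    split_ifs at hlt with hq'
    · exact one_div_pos.mpr (hpos q' hq')
    · linarith [hlb q']
  · simp only [slopeAngle] at hlt
    split_ifs at hlt with hq
    · linarith [hub q]
    · exact one_div_neg.mpr (h q rfl (not_le.mp hq))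
  · simp only [slopeAngle] at hlt
    split_ifs at hlt with hq' hq hq
    · have := Real.arctan_lt_arctan_iff.mp hlt
      exact one_div_lt_one_div_of_lt (hpos q' hq') (by linarith)
    · exact (one_div_neg.mpr (h q rfl (not_le.mp hq))).trans (one_div_pos.mpr (hpos q' hq'))
    · linarith [hub q, hlb q']
    · have := Real.arctan_lt_arctan_iff.mp (lt_of_add_lt_add_right hlt)
      exact one_div_lt_one_div_of_neg_of_lt (h q rfl (not_le.mp hq)) (by linarith)

/-! ### Positive turning counts descents of the slope angle -/

theorem sum_range_cyclic_succ {k : ℕ} (hk : 0 < k) (f : ℕ → ℝ) :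
    ∑ j ∈ Finset.range k, f ((j + 1) % k) = ∑ j ∈ Finset.range k, f j := by
  obtain ⟨k, rfl⟩ := Nat.exists_eq_succ_of_ne_zero hk.ne'
  rw [Finset.sum_range_succ, Nat.succ_eq_add_one, Nat.mod_self, Finset.sum_range_succ']
  congr 1
  refine Finset.sum_congr rfl fun j hj => ?_
  rw [Nat.mod_eq_of_lt (by simpa using hj)]

theorem posTurning_eq_card_mul_pi {k : ℕ} (hk : 0 < k) (s : ℕ → Slope) :
    posTurning k s = (((Finset.range k).filter fun j =>
      slopeAngle (s ((j + 1) % k)) < slopeAngle (s j)).card : ℝ) * Real.pi := by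
  have h : ∀ j, posAngle (s j) (s ((j + 1) % k)) =
      slopeAngle (s ((j + 1) % k)) - slopeAngle (s j) +
        if slopeAngle (s ((j + 1) % k)) < slopeAngle (s j) then Real.pi else 0 := by
    intro j
    simp only [posAngle, sub_neg]
    split_ifs <;> simp
  rw [posTurning, Finset.sum_congr rfl fun j _ => h j, Finset.sum_add_distrib,
    Finset.sum_sub_distrib, sum_range_cyclic_succ hk fun j => slopeAngle (s j), sub_self,
    zero_add, ← Finset.sum_filter, Finset.sum_const, nsmul_eq_mul]

theorem exists_two_descents {k : ℕ} (hk : 0 < k) (s : ℕ → Slope)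
    (hT : 2 * Real.pi ≤ posTurning k s) :
    ∃ a b, a < b ∧ b < k ∧ slopeAngle (s ((a + 1) % k)) < slopeAngle (s a) ∧
      slopeAngle (s ((b + 1) % k)) < slopeAngle (s b) := by
  rw [posTurning_eq_card_mul_pi hk] at hT
  have h2 := le_of_mul_le_mul_right hT Real.pi_pos
  obtain ⟨a, ha, b, hb, hab⟩ := Finset.one_lt_card.mp (Nat.succ_le_iff.mp (by exact_mod_cast h2))
  simp only [Finset.mem_filter, Finset.mem_range] at ha hb
  rcases lt_or_gt_of_ne hab with h | h
  · exact ⟨a, b, h, hb.1, ha.2, hb.2⟩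
  · exact ⟨b, a, h, ha.1, hb.2, ha.2⟩

/-! ### Monotone chains with spikes -/

/-- The ordinate of the `i`-th vertex of a chain of `N` upward edges of slopes `y`: its first edge
contributes an additional height `p`, its last edge an additional height `q`, and the remaining
height `1` is shared equally. -/
noncomputable def chainY (N : ℕ) (p q : ℝ) (i : ℕ) : ℝ :=
  (i : ℝ) / N + (if i = 0 then 0 else p) + (if i < N then 0 else q)

/-- The abscissa of the `i`-th vertex of the chain with ordinates `chainY N p q`. -/
noncomputable def chainX (N : ℕ) (y : ℕ → ℝ) (p q : ℝ) (i : ℕ) : ℝ :=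
  (∑ l ∈ Finset.range i, y l) / N + (if i = 0 then 0 else p * y 0) +
    (if i < N then 0 else q * y (N - 1))

/-- The height of the `i`-th edge of a chain, not counting its spike. -/
noncomputable def chainGap (N : ℕ) (p q : ℝ) (i : ℕ) : ℝ := chainY N p q (i + 1) - chainY N p q i

open Classical in
/-- The signed height reached by the `i`-th edge of a chain at its middle breakpoint: beyond the
final vertex by `δ` if a spike is needed there, and halfway otherwise. -/
noncomputable def chainMid (N : ℕ) (y : ℕ → ℝ) (p q δ : ℝ) (i : ℕ) : ℝ :=
  if i + 1 < N ∧ y i < y (i + 1) then chainGap N p q i + δ else chainGap N p q i / 2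

/-- The parameters of a chain are admissible if the spikes are short. -/
structure ChainParams (N : ℕ) (p q δ : ℝ) : Prop where
  N_pos : 0 < N
  p_pos : 0 < p
  q_pos : 0 < q
  δ_pos : 0 < δ
  δ_lt : δ < 1 / N

namespace ChainParams

variable {N : ℕ} {y : ℕ → ℝ} {p q δ : ℝ}

theorem natCast_pos (h : ChainParams N p q δ) : (0 : ℝ) < N := Nat.cast_pos.mpr h.N_pos

theorem chainY_zero (h : ChainParams N p q δ) : chainY N p q 0 = 0 := by
  simp [chainY, h.N_pos]

theorem chainX_zero (h : ChainParams N p q δ) : chainX N y p q 0 = 0 := by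
  simp [chainX, h.N_pos]

theorem chainY_mid {i : ℕ} (hi : 0 < i) (hiN : i < N) :
    chainY N p q i = i / N + p := by
  simp [chainY, hi.ne', hiN]

theorem chainX_mid {i : ℕ} (hi : 0 < i) (hiN : i < N) :
    chainX N y p q i = (∑ l ∈ Finset.range i, y l) / N + p * y 0 := by
  simp [chainX, hi.ne', hiN]

theorem chainY_top (h : ChainParams N p q δ) : chainY N p q N = 1 + p + q := by
  simp [chainY, h.N_pos.ne']

theorem chainX_top (h : ChainParams N p q δ) :
    chainX N y p q N = (∑ l ∈ Finset.range N, y l) / N + p * y 0 + q * y (N - 1) := by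
  simp [chainX, h.N_pos.ne']

theorem one_div_le_chainGap (h : ChainParams N p q δ) (i : ℕ) : 1 / (N : ℝ) ≤ chainGap N p q i := by
  have := h.p_pos
  have := h.q_pos
  have e : ((i : ℝ) + 1) / N = i / N + 1 / N := add_div ..
  simp only [chainGap, chainY, Nat.cast_add, Nat.cast_one, e]
  split_ifs <;> first | contradiction | omega | linarith

theorem chainGap_pos (h : ChainParams N p q δ) (i : ℕ) : 0 < chainGap N p q i :=
  (one_div_pos.mpr h.natCast_pos).trans_le (h.one_div_le_chainGap i)

theorem chainMid_pos (h : ChainParams N p q δ) (i : ℕ) : 0 < chainMid N y p q δ i := by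
  have := h.chainGap_pos i
  have := h.δ_pos
  rw [chainMid]
  split_ifs <;> linarith

theorem chainMid_ne (h : ChainParams N p q δ) (i : ℕ) :
    chainMid N y p q δ i ≠ chainGap N p q i := by
  have := h.chainGap_pos i
  have := h.δ_pos
  rw [chainMid]
  split_ifs <;> intro _ <;> linarith

theorem chainMid_le (h : ChainParams N p q δ) (i : ℕ) :
    chainMid N y p q δ i ≤ chainGap N p q i + δ := by
  have := h.chainGap_pos i
  have := h.δ_pos
  rw [chainMid]
  split_ifs <;> linarith

theorem chainMid_of_spike {i : ℕ} (hi : i + 1 < N ∧ y i < y (i + 1)) :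
    chainMid N y p q δ i = chainGap N p q i + δ := if_pos hi

theorem chainMid_of_not_spike {i : ℕ} (hi : ¬(i + 1 < N ∧ y i < y (i + 1))) :
    chainMid N y p q δ i = chainGap N p q i / 2 := if_neg hi

theorem chainGap_mul {i : ℕ} (hi : i < N) :
    chainX N y p q (i + 1) = chainX N y p q i + chainGap N p q i * y i := by
  have e : ((i : ℝ) + 1) / N = i / N + 1 / N := add_div ..
  simp only [chainGap, chainY, chainX, Nat.cast_add, Nat.cast_one, e, Finset.sum_range_succ, add_div,
    hi, Nat.succ_ne_zero, if_true, if_false]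
  rcases Nat.lt_or_ge (i + 1) N with h1 | h1
  · rcases Nat.eq_zero_or_pos i with rfl | h0
    · simp [h1]
      ring
    · simp [h1, h0.ne']
      ring
  · rw [show N - 1 = i by omega]
    rcases Nat.eq_zero_or_pos i with rfl | h0
    · simp [h1.not_gt]
      ring
    · simp [h1.not_gt, h0.ne']
      ring

theorem chainY_add_one_le (h : ChainParams N p q δ) {i j : ℕ} (hij : i < j) :
    chainY N p q i + 1 / N ≤ chainY N p q j := by
  obtain ⟨d, rfl⟩ := Nat.exists_eq_add_of_lt hij
  clear hij
  induction d with
  | zero =>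
    have := h.one_div_le_chainGap i
    rw [chainGap] at this
    rw [add_zero]
    linarith
  | succ d ih =>
    have := h.chainGap_pos (i + d + 1)
    rw [chainGap] at this
    rw [show i + (d + 1) + 1 = i + d + 1 + 1 by ring]
    linarith

/-- Two different edges of a chain meet at most in the common vertex. -/
theorem eq_of_mem_edges (h : ChainParams N p q δ) {i j : ℕ} (hij : i < j) (hj : j < N) {a b : ℝ}
    (ha : a ≤ max (chainGap N p q i) (chainMid N y p q δ i)) (hb : 0 ≤ b)
    (hX : chainX N y p q i + a * y i = chainX N y p q j + b * y j)
    (hY : chainY N p q i + a = chainY N p q j + b) : j = i + 1 ∧ b = 0 := by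
  have hδ := h.δ_pos
  have hδ' := h.δ_lt
  have hgap : chainGap N p q i = chainY N p q (i + 1) - chainY N p q i := rfl
  have ha' : a ≤ chainGap N p q i + δ := ha.trans (max_le (by linarith) (h.chainMid_le i))
  have hj1 : j = i + 1 := by
    by_contra hne
    have := h.chainY_add_one_le (i := i + 1) (j := j) (by omega)
    linarith
  subst hj1
  refine ⟨rfl, ?_⟩
  by_cases hs : y i < y (i + 1)
  · rw [chainGap_mul (by omega)] at hX
    have hab : a = chainGap N p q i + b := by linarith
    rw [hab] at hX
    have : b * (y (i + 1) - y i) = 0 := by linarith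
    exact (mul_eq_zero.mp this).resolve_right (by linarith)
  · have hg := h.chainGap_pos i
    rw [chainMid_of_not_spike (fun hh => hs hh.2), max_eq_left (by linarith)] at ha
    linarith

/-- Below height `p`, a chain consists of its first edge only. -/
theorem eq_zero_of_le (h : ChainParams N p q δ) {i : ℕ} (hi : i < N) {a : ℝ} (ha : 0 ≤ a)
    (hY : chainY N p q i + a ≤ p) : i = 0 := by
  by_contra h0
  rw [chainY_mid (by omega) hi] at hY
  have : 0 < (i : ℝ) / N := div_pos (by exact_mod_cast Nat.pos_of_ne_zero h0) h.natCast_pos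
  linarith

/-- Above height `p + 1`, a chain consists of its last edge only. -/
theorem eq_last_of_le (h : ChainParams N p q δ) {i : ℕ} (hi : i < N) {a : ℝ}
    (ha : a ≤ max (chainGap N p q i) (chainMid N y p q δ i))
    (hY : p + 1 ≤ chainY N p q i + a) : i + 1 = N := by
  by_contra h0
  have hδ := h.δ_pos
  have hδ' := h.δ_lt
  have hgap : chainGap N p q i = chainY N p q (i + 1) - chainY N p q i := rfl
  have ha' : a ≤ chainGap N p q i + δ := ha.trans (max_le (by linarith) (h.chainMid_le i))
  have h1 : chainY N p q (i + 1) = _ := chainY_mid (by omega) (by omega)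
  have h2 : ((i + 1 : ℕ) : ℝ) / N + 1 / N ≤ 1 := by
    rw [← add_div, div_le_one h.natCast_pos]
    exact_mod_cast (by omega : i + 1 + 1 ≤ N)
  linarith

theorem abs_sum_div_le (h : ChainParams N p q δ) {M : ℝ} (hM : ∀ l < N, |y l| ≤ M) {i : ℕ}
    (hi : i ≤ N) : |(∑ l ∈ Finset.range i, y l) / N| ≤ M := by
  have hN := h.natCast_pos
  have hM0 : 0 ≤ M := (abs_nonneg _).trans (hM 0 h.N_pos)
  rw [abs_div, abs_of_pos hN, div_le_iff₀ hN]
  calc |∑ l ∈ Finset.range i, y l| ≤ ∑ l ∈ Finset.range i, |y l| := Finset.abs_sum_le_sum_abs _ _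
    _ ≤ ∑ l ∈ Finset.range i, M :=
      Finset.sum_le_sum fun l hl => hM l ((Finset.mem_range.mp hl).trans_le hi)
    _ = i * M := by simp
    _ ≤ N * M := by gcongr
    _ = M * N := mul_comm _ _

/-- Between the heights `p` and `p + 1`, the abscissa of a chain is nearly constant. -/
theorem abs_sub_le (h : ChainParams N p q δ) {M : ℝ} (hM : ∀ l < N, |y l| ≤ M) {i : ℕ}
    (hi : i < N) {a : ℝ} (ha : 0 ≤ a) (hlow : p ≤ chainY N p q i + a)
    (hup : chainY N p q i + a ≤ p + 1) :
    |chainX N y p q i + a * y i - p * y 0| ≤ 2 * M := by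
  have hM0 : 0 ≤ M := (abs_nonneg _).trans (hM 0 h.N_pos)
  rcases Nat.eq_zero_or_pos i with rfl | h0
  · rw [h.chainY_zero, zero_add] at hlow hup
    rw [h.chainX_zero, zero_add, ← sub_mul, abs_mul, abs_of_nonneg (by linarith)]
    have : (a - p) * |y 0| ≤ 1 * M :=
      mul_le_mul (by linarith) (hM 0 hi) (abs_nonneg _) zero_le_one
    linarith
  · rw [chainY_mid h0 hi] at hup
    have : 0 ≤ (i : ℝ) / N := by positivity
    rw [chainX_mid h0 hi, show ∀ u v w : ℝ, u + v + w - v = u + w by intros; ring]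
    have h1 := abs_add_le ((∑ l ∈ Finset.range i, y l) / N) (a * y i)
    have h2 := h.abs_sum_div_le hM hi.le
    have h3 : a * |y i| ≤ 1 * M :=
      mul_le_mul (by linarith) (hM i hi) (abs_nonneg _) zero_le_one
    rw [abs_mul, abs_of_nonneg ha] at h1
    linarith

theorem turn_pos (h : ChainParams N p q δ) {i : ℕ} (hi : i + 1 < N) (hne : y i ≠ y (i + 1)) :
    0 < (chainGap N p q i - chainMid N y p q δ i) * (y i - y (i + 1)) := by
  have := h.chainGap_pos i
  have := h.δ_pos
  rcases lt_or_gt_of_ne hne with hlt | hlt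
  · rw [chainMid_of_spike ⟨hi, hlt⟩]
    exact mul_pos_of_neg_of_neg (by linarith) (by linarith)
  · rw [chainMid_of_not_spike fun hh => absurd hh.2 hlt.not_gt]
    exact mul_pos (by linarith) (by linarith)

theorem chainMid_last {i : ℕ} (hi : i + 1 = N) :
    chainMid N y p q δ i = chainGap N p q i / 2 :=
  chainMid_of_not_spike fun hh => by omega

end ChainParams

namespace ChainParams

variable {N N' : ℕ} {y y' : ℕ → ℝ} {p q δ : ℝ}

theorem bottom_of_mem_edges (h : ChainParams N p q δ) (h' : ChainParams N' q p δ)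
    (htop : chainX N y p q N = chainX N' y' q p N') (hbot : y' (N' - 1) < y 0) {i j : ℕ}
    (hi : i < N) (hj : j < N') {a b : ℝ} (ha : 0 ≤ a)
    (hb : b ≤ max (chainGap N' q p j) (chainMid N' y' q p δ j))
    (hX : chainX N y p q i + a * y i = chainX N y p q N - (chainX N' y' q p j + b * y' j))
    (hY : chainY N p q i + a = chainY N p q N - (chainY N' q p j + b))
    (hlow : chainY N p q i + a ≤ p) : i = 0 ∧ j + 1 = N' ∧ a = 0 := by
  have hY1 := h.chainY_top
  have hY2 := h'.chainY_top
  have hi0 := h.eq_zero_of_le hi ha hlow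
  have hjN := h'.eq_last_of_le hj hb (by linarith)
  refine ⟨hi0, hjN, ?_⟩
  have hg : chainGap N' q p j = chainY N' q p (j + 1) - chainY N' q p j := rfl
  have hm := chainGap_mul (y := y') (p := q) (q := p) hj
  subst hi0
  rw [hjN] at hm hg
  rw [h.chainX_zero] at hX
  rw [h.chainY_zero] at hY
  have hb' : b = chainGap N' q p j - a := by linarith
  have hy : y' j = y' (N' - 1) := by rw [← hjN, Nat.add_sub_cancel]
  rw [hb'] at hX
  have : a * (y 0 - y' j) = 0 := by linarith
  exact (mul_eq_zero.mp this).resolve_right (by rw [hy]; linarith)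

/-- A chain going up and a chain coming down from its top to its bottom, to the left of it, meet
at most in the top and the bottom. -/
theorem ends_of_mem_edges (h : ChainParams N p q δ) (h' : ChainParams N' q p δ)
    {M : ℝ} (hM : ∀ l < N, |y l| ≤ M) (hM' : ∀ l < N', |y' l| ≤ M)
    (htop : chainX N y p q N = chainX N' y' q p N') (hbot : y' (N' - 1) < y 0)
    (htop' : y (N - 1) < y' 0) (hwide : 5 * M < p * (y 0 - y' (N' - 1)))
    {i j : ℕ} (hi : i < N) (hj : j < N') {a b : ℝ} (ha : 0 ≤ a)
    (ha' : a ≤ max (chainGap N p q i) (chainMid N y p q δ i)) (hb : 0 ≤ b)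
    (hb' : b ≤ max (chainGap N' q p j) (chainMid N' y' q p δ j))
    (hX : chainX N y p q i + a * y i = chainX N y p q N - (chainX N' y' q p j + b * y' j))
    (hY : chainY N p q i + a = chainY N p q N - (chainY N' q p j + b)) :
    (i = 0 ∧ j + 1 = N' ∧ a = 0) ∨ (j = 0 ∧ i + 1 = N ∧ b = 0) := by
  have hY1 := h.chainY_top
  have hY2 := h'.chainY_top
  rcases le_total (chainY N p q i + a) p with hlow | hlow
  · exact Or.inl (h.bottom_of_mem_edges h' htop hbot hi hj ha hb' hX hY hlow)
  rcases le_total (p + 1) (chainY N p q i + a) with hup | hup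
  · exact Or.inr (h'.bottom_of_mem_edges h htop.symm htop' hj hi hb ha' (by linarith)
      (by linarith) (by linarith))
  exfalso
  have h1 := abs_le.mp (h.abs_sub_le hM hi ha hlow hup)
  have h2 := abs_le.mp (h'.abs_sub_le hM' hj hb (by linarith) (by linarith))
  have h3 := abs_le.mp (h'.abs_sum_div_le hM' le_rfl)
  have h4 := h'.chainX_top (y := y')
  linarith [h1.1, h1.2, h2.1, h2.2, h3.1, h3.2]

end ChainParams

/-! ### Zigzag loops -/

/-- A closed polygon with folds and with `k` edges (indexed periodically): the `j`-th edge starts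
at `(U j, Z j)` and moves along `σ j • (x j, 1)`, first by `τ j` and then (possibly backwards) to
the distance `h j`. -/
structure ZigzagLoop (k : ℕ) (x : ℕ → ℝ) where
  /-- abscissae of the vertices -/
  U : ℕ → ℝ
  /-- ordinates of the vertices -/
  Z : ℕ → ℝ
  /-- orientations of the edges -/
  σ : ℕ → ℝ
  /-- heights of the edges -/
  h : ℕ → ℝ
  /-- heights of the middle breakpoints -/
  τ : ℕ → ℝ
  U_periodic : ∀ j, U (j + k) = U j
  Z_periodic : ∀ j, Z (j + k) = Z j
  σ_periodic : ∀ j, σ (j + k) = σ j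
  h_pos : ∀ j, 0 < h j
  τ_pos : ∀ j, 0 < τ j
  τ_ne : ∀ j, τ j ≠ h j
  σ_ne : ∀ j, σ j ≠ 0
  U_succ : ∀ j, U (j + 1) = U j + σ j * h j * x j
  Z_succ : ∀ j, Z (j + 1) = Z j + σ j * h j
  turn : ∀ j, 0 < σ j * σ (j + 1) * ((h j - τ j) * (x j - x (j + 1)))
  sep : ∀ i j a b, 0 ≤ a → a ≤ max (h i) (τ i) → 0 ≤ b → b ≤ max (h j) (τ j) →
    U i + σ i * a * x i = U j + σ j * b * x j → Z i + σ i * a = Z j + σ j * b →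
    i ≡ j [MOD k] ∨ (j ≡ i + 1 [MOD k] ∧ b = 0) ∨ (i ≡ j + 1 [MOD k] ∧ a = 0)

namespace ZigzagLoop

variable {k : ℕ} {x : ℕ → ℝ}

/-- Renumbering the edges of a zigzag loop. -/
def shift (L : ZigzagLoop k x) (r : ℕ) : ZigzagLoop k fun j => x (j + r) where
  U j := L.U (j + r)
  Z j := L.Z (j + r)
  σ j := L.σ (j + r)
  h j := L.h (j + r)
  τ j := L.τ (j + r)
  U_periodic j := by rw [add_right_comm, L.U_periodic]
  Z_periodic j := by rw [add_right_comm, L.Z_periodic]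
  σ_periodic j := by rw [add_right_comm, L.σ_periodic]
  h_pos _ := L.h_pos _
  τ_pos _ := L.τ_pos _
  τ_ne _ := L.τ_ne _
  σ_ne _ := L.σ_ne _
  U_succ j := by rw [add_right_comm, L.U_succ]
  Z_succ j := by rw [add_right_comm, L.Z_succ]
  turn j := by rw [add_right_comm j 1 r]; exact L.turn _
  sep i j a b h1 h2 h3 h4 h5 h6 := by
    have := L.sep _ _ a b h1 h2 h3 h4 h5 h6
    rw [add_right_comm i r 1, add_right_comm j r 1] at this
    exact this.imp (Nat.ModEq.add_right_cancel' r) fun h =>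
      h.imp (And.imp_left (Nat.ModEq.add_right_cancel' r)) (And.imp_left (Nat.ModEq.add_right_cancel' r))

end ZigzagLoop

/-- A closed polygon with folds given by its first `k` edges. -/
def ZigzagLoop.ofBase {k : ℕ} {x : ℕ → ℝ} (hk : 0 < k) (hx : ∀ j, x (j % k) = x j)
    (U Z σ h τ : ℕ → ℝ) (hU : U k = U 0) (hZ : Z k = Z 0) (hσ : σ k = σ 0)
    (h_pos : ∀ j < k, 0 < h j) (τ_pos : ∀ j < k, 0 < τ j) (τ_ne : ∀ j < k, τ j ≠ h j)
    (σ_ne : ∀ j < k, σ j ≠ 0) (U_succ : ∀ j < k, U (j + 1) = U j + σ j * h j * x j)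
    (Z_succ : ∀ j < k, Z (j + 1) = Z j + σ j * h j)
    (turn : ∀ j < k, 0 < σ j * σ (j + 1) * ((h j - τ j) * (x j - x (j + 1))))
    (sep : ∀ i < k, ∀ j < k, ∀ a b, i ≠ j → 0 ≤ a → a ≤ max (h i) (τ i) → 0 ≤ b →
      b ≤ max (h j) (τ j) →
      U i + σ i * a * x i = U j + σ j * b * x j → Z i + σ i * a = Z j + σ j * b →
      (j = (i + 1) % k ∧ b = 0) ∨ (i = (j + 1) % k ∧ a = 0)) : ZigzagLoop k x := by
  have hlt := fun j => Nat.mod_lt j hk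
  have hsucc : ∀ (f : ℕ → ℝ), f k = f 0 → ∀ j, f ((j + 1) % k) = f (j % k + 1) := by
    intro f hf j
    rw [← Nat.mod_add_mod]
    rcases (Nat.succ_le_of_lt (hlt j)).lt_or_eq with h | h
    · rw [Nat.mod_eq_of_lt h]
    · rw [← Nat.succ_eq_add_one, h, Nat.mod_self, hf]
  have hx1 : ∀ j, x (j % k + 1) = x (j + 1) := fun j => by
    rw [← hx (j % k + 1), Nat.mod_add_mod, hx]
  exact {
    U := fun j => U (j % k)
    Z := fun j => Z (j % k)
    σ := fun j => σ (j % k)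
    h := fun j => h (j % k)
    τ := fun j => τ (j % k)
    U_periodic := fun j => by rw [Nat.add_mod_right]
    Z_periodic := fun j => by rw [Nat.add_mod_right]
    σ_periodic := fun j => by rw [Nat.add_mod_right]
    h_pos := fun j => h_pos _ (hlt j)
    τ_pos := fun j => τ_pos _ (hlt j)
    τ_ne := fun j => τ_ne _ (hlt j)
    σ_ne := fun j => σ_ne _ (hlt j)
    U_succ := fun j => by rw [hsucc U hU, U_succ _ (hlt j), hx]
    Z_succ := fun j => by rw [hsucc Z hZ, Z_succ _ (hlt j)]
    turn := fun j => by
      have := turn _ (hlt j)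
      rwa [hx1, hx, ← hsucc σ hσ] at this
    sep := fun i j a b h1 h2 h3 h4 h5 h6 => by
      by_cases hij : i % k = j % k
      · exact Or.inl hij
      · rw [← hx i, ← hx j] at h5
        have := sep _ (hlt i) _ (hlt j) a b hij h1 h2 h3 h4 h5 h6
        rw [Nat.mod_add_mod, Nat.mod_add_mod] at this
        exact Or.inr this }

/-- The width parameters of the loop made of two chains: it closes up at the top, and it is wide
compared to the size of the zigzags. -/
theorem exists_chain_heights {A B M u v : ℝ} (hA : 0 < A) (hB : 0 < B) (hu : |u| ≤ M)
    (hv : |v| ≤ M) : ∃ p q : ℝ, 0 < p ∧ 0 < q ∧ 5 * M < p * A ∧ q * B = p * A + u - v := by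
  have hM : 0 ≤ M := (abs_nonneg u).trans hu
  have hpA : (5 * M + 1) / A * A = 5 * M + 1 := div_mul_cancel₀ _ hA.ne'
  refine ⟨(5 * M + 1) / A, (5 * M + 1 + u - v) / B, by positivity,
    div_pos ?_ hB, by linarith, ?_⟩
  · linarith [(abs_le.mp hu).1, (abs_le.mp hv).2]
  · rw [div_mul_cancel₀ _ hB.ne', hpA]

/-- A cyclic list of abscissae with an ascent at its end and another ascent inside is the list of
the edge directions of a zigzag loop. -/
theorem exists_zigzagLoop_of_ascents {k n : ℕ} {x : ℕ → ℝ} (hx : ∀ j, x (j % k) = x j)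
    (hn : 0 < n) (hnk : n < k) (hne : ∀ j, x j ≠ x (j + 1)) (htop : x (n - 1) < x n)
    (hbot : x (k - 1) < x 0) : Nonempty (ZigzagLoop k x) := by
  obtain ⟨m, rfl⟩ := Nat.exists_eq_add_of_lt hnk
  rw [add_assoc] at *
  set n' := m + 1 with hn'
  set x' : ℕ → ℝ := fun l => x (n + l) with hx'
  obtain ⟨M, hM⟩ : ∃ M, ∀ l < n + n', |x l| ≤ M :=
    ⟨∑ l ∈ Finset.range (n + n'), |x l|, fun l hl =>
      Finset.single_le_sum (fun i _ => abs_nonneg (x i)) (Finset.mem_range.mpr hl)⟩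
  have hM1 : ∀ l < n, |x l| ≤ M := fun l hl => hM l (by omega)
  have hM2 : ∀ l < n', |x' l| ≤ M := fun l hl => hM _ (by omega)
  obtain ⟨δ, hδ0, hδ⟩ : ∃ δ : ℝ, 0 < δ ∧ δ < 1 / (n + n') :=
    exists_between (by positivity)
  have hpar : ∀ p q : ℝ, 0 < p → 0 < q → ChainParams n p q δ := fun p q hp hq =>
    ⟨hn, hp, hq, hδ0, hδ.trans_le (one_div_le_one_div_of_le (by exact_mod_cast hn) (by simp))⟩
  have hpar' : ∀ p q : ℝ, 0 < p → 0 < q → ChainParams n' p q δ := fun p q hp hq =>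
    ⟨by omega, hp, hq, hδ0,
      hδ.trans_le (one_div_le_one_div_of_le (by positivity) (by simp))⟩
  obtain ⟨p, q, hp, hq, hwide, hclose⟩ := exists_chain_heights
    (sub_pos.mpr hbot) (sub_pos.mpr htop) ((hpar 1 1 one_pos one_pos).abs_sum_div_le hM1 le_rfl)
    ((hpar' 1 1 one_pos one_pos).abs_sum_div_le hM2 le_rfl)
  have h := hpar p q hp hq
  have h' := hpar' q p hq hp
  have hx'0 : x' 0 = x n := by simp [hx']
  have hx'l : x' (n' - 1) = x (n + n' - 1) := by rw [hx']; congr 1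
  have hXtop : chainX n x p q n = chainX n' x' q p n' := by
    rw [h.chainX_top, h'.chainX_top, hx'0, hx'l]
    linarith
  have hYtop : chainY n p q n = chainY n' q p n' := by
    rw [h.chainY_top, h'.chainY_top]
    ring
  have hYpos := h.chainY_top
  have hYpos' := h'.chainY_top
  have hxk : x (n + n') = x 0 := by rw [← hx (n + n'), Nat.mod_self]
  have hup : ∀ j < n + n', j < n ∨ ∃ l < n', j = n + l := fun j hj => by
    rcases Nat.lt_or_ge j n with h1 | h1
    · exact Or.inl h1
    · exact Or.inr ⟨j - n, by omega, by omega⟩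
  have hnl : ∀ l, ¬ n + l < n := fun l => by omega
  refine ⟨ZigzagLoop.ofBase (by omega) hx
    (fun j => if j < n then chainX n x p q j else chainX n x p q n - chainX n' x' q p (j - n))
    (fun j => if j < n then chainY n p q j else chainY n p q n - chainY n' q p (j - n))
    (fun j => if j < n then 1 else if j < n + n' then -1 else 1)
    (fun j => if j < n then chainGap n p q j else chainGap n' q p (j - n))
    (fun j => if j < n then chainMid n x p q δ j else chainMid n' x' q p δ (j - n))
    ?_ ?_ ?_ ?_ ?_ ?_ ?_ ?_ ?_ ?_ ?_⟩
  · simp [hn, hXtop, h.chainX_zero]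
  · simp [hn, hYtop, h.chainY_zero]
  · simp [hn]
  · intro j _
    split_ifs
    exacts [h.chainGap_pos _, h'.chainGap_pos _]
  · intro j _
    split_ifs
    exacts [h.chainMid_pos _, h'.chainMid_pos _]
  · intro j _
    split_ifs
    exacts [h.chainMid_ne _, h'.chainMid_ne _]
  · intro j _
    split_ifs <;> norm_num
  · intro j hj
    rcases hup j hj with h1 | ⟨l, hl, rfl⟩
    · have hm := ChainParams.chainGap_mul (y := x) (p := p) (q := q) h1
      rcases Nat.lt_or_ge (j + 1) n with h2 | h2
      · simp only [h1, h2, if_true, hm]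
        ring
      · obtain rfl : n = j + 1 := by omega
        simp [hm, h'.chainX_zero]
    · have hm := ChainParams.chainGap_mul (y := x') (p := q) (q := p) hl
      simp only [hnl, add_assoc, Nat.add_sub_cancel_left, if_false, hm, Nat.add_lt_add_iff_left, hl,
        if_true]
      simp only [hx']
      ring
  · intro j hj
    rcases hup j hj with h1 | ⟨l, hl, rfl⟩
    · rcases Nat.lt_or_ge (j + 1) n with h2 | h2
      · simp only [h1, h2, if_true, chainGap]
        ring
      · obtain rfl : n = j + 1 := by omega
        simp [chainGap, h'.chainY_zero]
    · simp only [hnl, add_assoc, Nat.add_sub_cancel_left, if_false, chainGap,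
        Nat.add_lt_add_iff_left, hl, if_true]
      ring
  · intro j hj
    rcases hup j hj with h1 | ⟨l, hl, rfl⟩
    · rcases Nat.lt_or_ge (j + 1) n with h2 | h2
      · simp only [h1, h2, if_true, one_mul]
        exact h.turn_pos h2 (hne j)
      · obtain rfl : n = j + 1 := by omega
        have hg := h.chainGap_pos j
        simp only [h1, if_true, lt_irrefl, if_false, hj, ChainParams.chainMid_last rfl]
        rw [Nat.add_sub_cancel] at htop
        have hj' : j + 1 < j + 1 + n' := by omega
        rw [if_pos hj']
        nlinarith [mul_pos hg (sub_pos.mpr htop)]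
    · simp only [hnl, add_assoc, Nat.add_sub_cancel_left, if_false, Nat.add_lt_add_iff_left, hl,
        if_true]
      rcases Nat.lt_or_ge (l + 1) n' with h2 | h2
      · simp only [h2, if_true]
        have := h'.turn_pos (y := x') h2 (hne (n + l))
        simp only [hx', ← add_assoc] at this ⊢
        linarith
      · have h3 : l + 1 = n' := by omega
        have hg := h'.chainGap_pos l
        simp only [h2.not_gt, if_false, ChainParams.chainMid_last h3]
        rw [h3, hxk]
        rw [← h3, ← add_assoc, Nat.add_sub_cancel] at hbot
        rw [← h3] at hg ⊢
        nlinarith [mul_pos hg (sub_pos.mpr hbot)]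
  · intro i hi j hj a b hij ha ha' hb hb' hX hY
    rcases hup i hi with h1 | ⟨l, hl, rfl⟩ <;> rcases hup j hj with h2 | ⟨l', hl', rfl⟩
    · simp only [h1, h2, if_true, one_mul] at ha' hb' hX hY
      rcases lt_or_gt_of_ne hij with hlt | hlt
      · obtain ⟨e, hb0⟩ := h.eq_of_mem_edges hlt h2 ha' hb hX hY
        exact Or.inl ⟨by rw [← e, Nat.mod_eq_of_lt hj], hb0⟩
      · obtain ⟨e, ha0⟩ := h.eq_of_mem_edges hlt h1 hb' ha hX.symm hY.symm
        exact Or.inr ⟨by rw [← e, Nat.mod_eq_of_lt hi], ha0⟩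
    · simp only [h1, hnl, if_true, if_false, one_mul, Nat.add_sub_cancel_left,
        Nat.add_lt_add_iff_left, hl'] at ha' hb' hX hY
      rcases h.ends_of_mem_edges h' hM1 hM2 hXtop (by rwa [hx'l]) (by rwa [hx'0])
        (by rwa [hx'l]) h1 hl' ha ha' hb hb' (by simp only [hx']; linarith) (by linarith) with
        ⟨e, e', e''⟩ | ⟨e, e', e''⟩
      · exact Or.inr ⟨by rw [add_assoc, e', Nat.mod_self, e], e''⟩
      · exact Or.inl ⟨by rw [e', e, add_zero, Nat.mod_eq_of_lt hnk], e''⟩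
    · simp only [h2, hnl, if_true, if_false, one_mul, Nat.add_sub_cancel_left,
        Nat.add_lt_add_iff_left, hl] at ha' hb' hX hY
      rcases h.ends_of_mem_edges h' hM1 hM2 hXtop (by rwa [hx'l]) (by rwa [hx'0])
        (by rwa [hx'l]) h2 hl hb hb' ha ha' (by simp only [hx']; linarith) (by linarith) with
        ⟨e, e', e''⟩ | ⟨e, e', e''⟩
      · exact Or.inl ⟨by rw [add_assoc, e', Nat.mod_self, e], e''⟩
      · exact Or.inr ⟨by rw [e', e, add_zero, Nat.mod_eq_of_lt hnk], e''⟩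
    · simp only [hnl, if_true, if_false, Nat.add_sub_cancel_left,
        Nat.add_lt_add_iff_left, hl, hl'] at ha' hb' hX hY
      rcases lt_or_gt_of_ne hij with hlt | hlt
      · obtain ⟨e, hb0⟩ := h'.eq_of_mem_edges (y := x') (by omega) hl' ha' hb
          (by simp only [hx']; linarith) (by linarith)
        exact Or.inl ⟨by rw [add_assoc, ← e, Nat.mod_eq_of_lt hj], hb0⟩
      · obtain ⟨e, ha0⟩ := h'.eq_of_mem_edges (y := x') (by omega) hl hb' ha
          (by simp only [hx']; linarith) (by linarith)
        exact Or.inr ⟨by rw [add_assoc, ← e, Nat.mod_eq_of_lt hi], ha0⟩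

/-! ### The path of a zigzag loop -/

/-- The distance reached at time `u ∈ [0,1]` when moving to `τ` on `[0,1/2]` and from there to `h`
on `[1/2,1]`. -/
noncomputable def zigzag (τ h u : ℝ) : ℝ :=
  if u ≤ 1 / 2 then 2 * u * τ else (2 - 2 * u) * τ + (2 * u - 1) * h

section zigzag

variable {τ h u : ℝ}

theorem zigzag_of_le (hu : u ≤ 1 / 2) : zigzag τ h u = 2 * u * τ := if_pos hu

theorem zigzag_of_ge (hu : 1 / 2 ≤ u) : zigzag τ h u = (2 - 2 * u) * τ + (2 * u - 1) * h := by
  rcases hu.eq_or_lt with rfl | hu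
  · rw [zigzag_of_le le_rfl]
    ring
  · exact if_neg hu.not_ge

theorem zigzag_zero : zigzag τ h 0 = 0 := by
  rw [zigzag_of_le (by norm_num)]
  ring

theorem zigzag_one : zigzag τ h 1 = h := by
  rw [zigzag_of_ge (by norm_num)]
  ring

theorem zigzag_nonneg (hτ : 0 < τ) (hh : 0 < h) (h0 : 0 ≤ u) (h1 : u ≤ 1) : 0 ≤ zigzag τ h u := by
  rcases le_total u (1 / 2) with hu | hu
  · rw [zigzag_of_le hu]
    positivity
  · rw [zigzag_of_ge hu]
    exact add_nonneg (mul_nonneg (by linarith) hτ.le) (mul_nonneg (by linarith) hh.le)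

theorem zigzag_le_max (hτ : 0 < τ) (h1 : u ≤ 1) : zigzag τ h u ≤ max h τ := by
  rcases le_total u (1 / 2) with hu | hu
  · rw [zigzag_of_le hu]
    refine le_trans ?_ (le_max_right _ _)
    nlinarith
  · rw [zigzag_of_ge hu]
    nlinarith [le_max_right h τ, le_max_left h τ]

theorem eq_zero_of_zigzag_eq_zero (hτ : 0 < τ) (hh : 0 < h) (h1 : u ≤ 1)
    (hz : zigzag τ h u = 0) : u = 0 := by
  rcases le_total u (1 / 2) with hu | hu
  · rw [zigzag_of_le hu] at hz
    have := (mul_eq_zero.mp hz).resolve_right hτ.ne'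
    linarith
  · rw [zigzag_of_ge hu] at hz
    have e1 : 0 ≤ (2 - 2 * u) * τ := mul_nonneg (by linarith) hτ.le
    have e2 : 0 ≤ (2 * u - 1) * h := mul_nonneg (by linarith) hh.le
    rcases hu.eq_or_lt with rfl | hu
    · norm_num at hz
      linarith
    · have : 0 < (2 * u - 1) * h := mul_pos (by linarith) hh
      linarith

theorem eq_of_zigzag_eq_left {v : ℝ} (hτ : 0 < τ) (hu : u ≤ 1 / 2) (hv : v ≤ 1 / 2)
    (huv : zigzag τ h u = zigzag τ h v) : u = v := by
  rw [zigzag_of_le hu, zigzag_of_le hv] at huv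
  linarith [mul_right_cancel₀ hτ.ne' huv]

theorem eq_of_zigzag_eq_right {v : ℝ} (hne : τ ≠ h) (hu : 1 / 2 ≤ u) (hv : 1 / 2 ≤ v)
    (huv : zigzag τ h u = zigzag τ h v) : u = v := by
  rw [zigzag_of_ge hu, zigzag_of_ge hv] at huv
  have : (u - v) * (h - τ) = 0 := by linarith
  linarith [(mul_eq_zero.mp this).resolve_right (sub_ne_zero.mpr hne.symm)]

theorem eq_of_zigzag_eq_end {v : ℝ} (hτ : 0 < τ) (hne : τ ≠ h) (hu : u < 1) (hv : v < 1)
    (hzu : zigzag τ h u = h) (hzv : zigzag τ h v = h) : u = v := by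
  have key : ∀ w < 1, zigzag τ h w = h → w ≤ 1 / 2 := fun w hw hz => by
    by_contra! hlt
    exact hw.ne (eq_of_zigzag_eq_right hne hlt.le (by norm_num) (hz.trans zigzag_one.symm))
  exact eq_of_zigzag_eq_left hτ (key u hu hzu) (key v hv hzv) (hzu.trans hzv.symm)

theorem not_zigzag_eq_three {v w : ℝ} (hτ : 0 < τ) (hne : τ ≠ h) (huv : u < v) (hvw : v < w)
    (h1 : zigzag τ h u = zigzag τ h v) (h2 : zigzag τ h v = zigzag τ h w) : False := by
  rcases le_total v (1 / 2) with hv | hv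
  · exact huv.ne (eq_of_zigzag_eq_left hτ (huv.le.trans hv) hv h1)
  · exact hvw.ne (eq_of_zigzag_eq_right hne hv (hv.trans hvw.le) h2)

end zigzag

namespace ZigzagLoop

variable {k : ℕ} {x : ℕ → ℝ} (L : ZigzagLoop k x) (ε : ℝ)

/-- The point of the line containing the `j`-th edge at the signed distance `a` from its initial
vertex. -/
def pt (j : ℕ) (a : ℝ) : ℝ × ℝ :=
  (L.U j + L.σ j * a * x j, L.Z j + L.σ j * a - ε * (L.U j + L.σ j * a * x j))

/-- The parametrization of a zigzag loop by `[0, k]`. -/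
noncomputable def path (t : ℝ) : ℝ × ℝ :=
  L.pt ε ⌊t⌋₊ (zigzag (L.τ ⌊t⌋₊) (L.h ⌊t⌋₊) (t - ⌊t⌋₊))

theorem pt_succ_zero (j : ℕ) : L.pt ε (j + 1) 0 = L.pt ε j (L.h j) := by
  simp [pt, L.U_succ, L.Z_succ]

theorem pt_periodic_zero (j : ℕ) : L.pt ε (j + k) 0 = L.pt ε j 0 := by
  simp [pt, L.U_periodic, L.Z_periodic]

theorem pt_injective {j : ℕ} {a b : ℝ} (h : L.pt ε j a = L.pt ε j b) : a = b := by
  simp only [pt, Prod.mk.injEq] at h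
  have : L.σ j * a = L.σ j * b := by
    have := h.2
    rw [h.1] at this
    linarith
  exact mul_left_cancel₀ (L.σ_ne j) this

theorem pt_sub_pt (j : ℕ) (a b : ℝ) :
    L.pt ε j a - L.pt ε j b = (L.σ j * (a - b)) • (x j, 1 - ε * x j) := by
  ext <;> simp [pt] <;> ring

theorem pt_add_smul (j : ℕ) (a b r : ℝ) :
    L.pt ε j a + r • (L.pt ε j b - L.pt ε j a) = L.pt ε j (a + r * (b - a)) := by
  ext <;> simp [pt] <;> ring

theorem sep_pt {i j : ℕ} {a b : ℝ} (ha : 0 ≤ a) (ha' : a ≤ max (L.h i) (L.τ i)) (hb : 0 ≤ b)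
    (hb' : b ≤ max (L.h j) (L.τ j)) (heq : L.pt ε i a = L.pt ε j b) :
    i ≡ j [MOD k] ∨ (j ≡ i + 1 [MOD k] ∧ b = 0) ∨ (i ≡ j + 1 [MOD k] ∧ a = 0) := by
  simp only [pt, Prod.mk.injEq] at heq
  refine L.sep i j a b ha ha' hb hb' heq.1 ?_
  have := heq.2
  rw [heq.1] at this
  linarith

theorem path_of_mem {j : ℕ} {t : ℝ} (ht : t ∈ Set.Icc (j : ℝ) (j + 1)) :
    L.path ε t = L.pt ε j (zigzag (L.τ j) (L.h j) (t - j)) := by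
  rcases ht.2.lt_or_eq with h | rfl
  · have : ⌊t⌋₊ = j := (Nat.floor_eq_iff ((Nat.cast_nonneg j).trans ht.1)).mpr ⟨ht.1, h⟩
    rw [path, this]
  · have : ⌊(j : ℝ) + 1⌋₊ = j + 1 := by exact_mod_cast Nat.floor_natCast (R := ℝ) (j + 1)
    rw [path, this, Nat.cast_succ, sub_self, zigzag_zero, add_sub_cancel_left, zigzag_one,
      pt_succ_zero]

theorem path_natCast (j : ℕ) : L.path ε j = L.pt ε j 0 := by
  rw [L.path_of_mem ε (j := j) (by simp), sub_self, zigzag_zero]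

theorem path_half (j : ℕ) : L.path ε (j + 1 / 2) = L.pt ε j (L.τ j) := by
  rw [L.path_of_mem ε (j := j) (by constructor <;> linarith), add_sub_cancel_left,
    zigzag_of_le le_rfl]
  ring_nf

theorem path_succ (j : ℕ) : L.path ε (j + 1) = L.pt ε j (L.h j) := by
  rw [← pt_succ_zero, ← path_natCast, Nat.cast_succ]

theorem zigzag_mem_of_mem {j : ℕ} {t : ℝ} (ht : t ∈ Set.Icc (j : ℝ) (j + 1)) :
    0 ≤ zigzag (L.τ j) (L.h j) (t - j) ∧
      zigzag (L.τ j) (L.h j) (t - j) ≤ max (L.h j) (L.τ j) :=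
  ⟨zigzag_nonneg (L.τ_pos j) (L.h_pos j) (by linarith [ht.1]) (by linarith [ht.2]),
    zigzag_le_max (L.τ_pos j) (by linarith [ht.2])⟩

/-- The piecewise-linear path of a zigzag loop, with two pieces for each edge. -/
noncomputable def toPLPathData (hk : 0 < k) : PLPathData where
  k := k
  kpos := hk
  γ := L.path ε
  m := 2 * k
  t i := i / 2
  vi j := 2 * j
  t_mono i _ := by push_cast; linarith
  t_first := by simp
  t_last := by push_cast; ring
  vi_le j hj := by omega
  vi_t j _ := by push_cast; ring
  affine i _ y hy := by
    obtain ⟨hy1, hy2⟩ := hy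
    obtain ⟨j, rfl | rfl⟩ := Nat.even_or_odd' i
    · push_cast at hy1 hy2 ⊢
      have e1 : 2 * (j : ℝ) / 2 = j := by ring
      have e2 : (2 * (j : ℝ) + 1) / 2 = j + 1 / 2 := by ring
      rw [e1] at hy1 ⊢
      rw [e2] at hy2 ⊢
      rw [path_natCast, path_half, pt_add_smul,
        L.path_of_mem ε (j := j) ⟨hy1, by linarith⟩, zigzag_of_le (by linarith)]
      congr 1
      ring
    · push_cast at hy1 hy2 ⊢
      have e2 : (2 * (j : ℝ) + 1) / 2 = j + 1 / 2 := by ring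
      have e3 : (2 * (j : ℝ) + 1 + 1) / 2 = j + 1 := by ring
      rw [e2] at hy1 ⊢
      rw [e3] at hy2 ⊢
      rw [path_succ, path_half, pt_add_smul,
        L.path_of_mem ε (j := j) ⟨by linarith, hy2⟩, zigzag_of_ge (by linarith)]
      congr 1
      ring
  nonconst i _ h := by
    obtain ⟨j, rfl | rfl⟩ := Nat.even_or_odd' i
    · push_cast at h
      rw [show 2 * (j : ℝ) / 2 = j by ring, show (2 * (j : ℝ) + 1) / 2 = j + 1 / 2 by ring,
        path_natCast, path_half] at h
      exact (L.τ_pos j).ne' (L.pt_injective ε h)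
    · push_cast at h
      rw [show (2 * (j : ℝ) + 1 + 1) / 2 = j + 1 by ring,
        show (2 * (j : ℝ) + 1) / 2 = j + 1 / 2 by ring, path_succ, path_half] at h
      exact L.τ_ne j (L.pt_injective ε h).symm

variable {hk : 0 < k}

theorem dir_even (j : ℕ) : (L.toPLPathData ε hk).dir (2 * j) =
    (L.σ j * L.τ j) • (x j, 1 - ε * x j) := by
  simp only [PLPathData.dir, toPLPathData]
  push_cast
  rw [show 2 * (j : ℝ) / 2 = j by ring, show (2 * (j : ℝ) + 1) / 2 = j + 1 / 2 by ring,
    path_natCast, path_half, pt_sub_pt, sub_zero]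

theorem dir_odd (j : ℕ) : (L.toPLPathData ε hk).dir (2 * j + 1) =
    (L.σ j * (L.h j - L.τ j)) • (x j, 1 - ε * x j) := by
  simp only [PLPathData.dir, toPLPathData]
  push_cast
  rw [show (2 * (j : ℝ) + 1 + 1) / 2 = j + 1 by ring,
    show (2 * (j : ℝ) + 1) / 2 = j + 1 / 2 by ring, path_succ, path_half, pt_sub_pt]

theorem realizes {s : ℕ → Slope} (hε : 0 < ε)
    (hs : ∀ j < k, ShearAdmissible ε (s j)) (hx : ∀ j < k, x j = shearedSlope ε (s j))
    (hne : ∀ j, j + 1 < k → s j ≠ s (j + 1)) : (L.toPLPathData ε hk).Realizes s := by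
  refine ⟨fun j hj t ht => ?_, hne⟩
  have hc := cross_shearedSlope_primVecR hε (hs j hj)
  rw [← hx j hj] at hc
  change cross (L.path ε t - L.path ε j) _ = 0
  rw [L.path_of_mem ε ht, path_natCast, pt_sub_pt]
  simp only [cross, Prod.smul_mk, smul_eq_mul] at hc ⊢
  linear_combination (L.σ j * (zigzag (L.τ j) (L.h j) (t - j) - 0)) * hc

theorem isLoop : (L.toPLPathData ε hk).IsLoop := by
  change L.path ε k = L.path ε 0
  have := L.pt_periodic_zero ε 0
  rw [zero_add] at this
  rw [path_natCast, this, ← path_natCast, Nat.cast_zero]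

theorem path_half_ne_vertex (i j : ℕ) : L.path ε (i + 1 / 2) ≠ L.path ε j := by
  rw [path_half, path_natCast]
  intro h
  have hper : ∀ i j : ℕ, i ≡ j [MOD k] → L.pt ε i 0 = L.pt ε j 0 := by
    have key : ∀ i d : ℕ, L.pt ε (i + k * d) 0 = L.pt ε i 0 := fun i d => by
      induction d with
      | zero => simp
      | succ d ih => rw [Nat.mul_succ, ← add_assoc, pt_periodic_zero, ih]
    intro i j hij
    rw [← Nat.mod_add_div i k, ← Nat.mod_add_div j k, key, key, hij]
  rcases L.sep_pt ε (L.τ_pos i).le (le_max_right _ _) le_rfl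
    ((L.h_pos j).le.trans (le_max_left _ _)) h with h1 | ⟨h1, -⟩ | ⟨-, h1⟩
  · rw [← hper i j h1] at h
    exact (L.τ_pos i).ne' (L.pt_injective ε h)
  · rw [hper j (i + 1) h1, pt_succ_zero] at h
    exact L.τ_ne i (L.pt_injective ε h)
  · exact (L.τ_pos i).ne' h1

theorem rightPolygonalLoopFor {s : ℕ → Slope} (hxk : x k = x 0)
    (hrp : ∀ j < k, (primDet (s j) (s ((j + 1) % k))).natAbs = 1) :
    (L.toPLPathData ε hk).RightPolygonalLoopFor s := by
  refine ⟨L.isLoop ε, ?_, ?_⟩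
  · rintro i ⟨-, hi, hnot, -⟩ j -
    change i < 2 * k at hi
    obtain ⟨l, rfl | rfl⟩ := Nat.even_or_odd' i
    · refine absurd ?_ (hnot l (by change l ≤ k; omega))
      simp only [toPLPathData]
      push_cast
      ring
    · change L.path ε (((2 * l + 1 : ℕ) : ℝ) / 2) ≠ L.path ε j
      push_cast
      rw [show (2 * (l : ℝ) + 1) / 2 = l + 1 / 2 by ring]
      exact L.path_half_ne_vertex ε l j
  · intro j hj1 hjk
    obtain ⟨l, rfl⟩ := Nat.exists_eq_add_of_le' hj1
    change l + 1 ≤ k at hjk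
    change (primDet (s (l + 1 - 1)) (s ((l + 1) % k))).natAbs = 1 ∧
      0 < cross ((L.toPLPathData ε hk).dir (2 * (l + 1) - 1))
        ((L.toPLPathData ε hk).dir (2 * ((l + 1) % k)))
    refine ⟨by simpa using hrp l (by omega), ?_⟩
    have hmod : L.σ ((l + 1) % k) = L.σ (l + 1) ∧ x ((l + 1) % k) = x (l + 1) := by
      rcases hjk.lt_or_eq with h | h
      · rw [Nat.mod_eq_of_lt h]
        exact ⟨rfl, rfl⟩
      · have := L.σ_periodic 0
        rw [zero_add] at this
        rw [h, Nat.mod_self, hxk, this]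
        exact ⟨rfl, rfl⟩
    rw [show 2 * (l + 1) - 1 = 2 * l + 1 by omega, dir_odd, dir_even, hmod.1, hmod.2]
    have h1 := mul_pos (L.turn l) (L.τ_pos ((l + 1) % k))
    simp only [cross, Prod.smul_mk, smul_eq_mul]
    linarith

/-- Points shared by two edges, in terms of the parameters of these edges. -/
theorem sep_path {i j : ℕ} (hij : i < j) (hj : j < k) {t t' : ℝ}
    (ht : t ∈ Set.Icc (i : ℝ) (i + 1)) (ht' : t' ∈ Set.Icc (j : ℝ) (j + 1))
    (heq : L.path ε t = L.path ε t') :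
    (j = i + 1 ∧ t' = j) ∨ (i = 0 ∧ j + 1 = k ∧ t = i) := by
  obtain ⟨a1, a2⟩ := L.zigzag_mem_of_mem ht
  obtain ⟨b1, b2⟩ := L.zigzag_mem_of_mem ht'
  rw [L.path_of_mem ε ht, L.path_of_mem ε ht'] at heq
  rcases L.sep_pt ε a1 a2 b1 b2 heq with h | ⟨h, hz⟩ | ⟨h, hz⟩
  · exact absurd (h.eq_of_lt_of_lt (hij.trans hj) hj) hij.ne
  · refine Or.inl ⟨h.eq_of_lt_of_lt hj (by omega), ?_⟩
    have := eq_zero_of_zigzag_eq_zero (L.τ_pos j) (L.h_pos j) (by linarith [ht'.2]) hz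
    linarith
  · refine Or.inr ?_
    have := eq_zero_of_zigzag_eq_zero (L.τ_pos i) (L.h_pos i) (by linarith [ht.2]) hz
    rcases (Nat.succ_le_of_lt hj).lt_or_eq with h' | h'
    · exact absurd (h.eq_of_lt_of_lt (hij.trans hj) h') (by omega)
    · have h'' : j + 1 = k := h'
      rw [h''] at h
      have h0 : i = 0 :=
        (h.trans (show k % k = 0 % k by simp)).eq_of_lt_of_lt (hij.trans hj) (by omega)
      exact ⟨h0, h'', by linarith⟩

theorem embeddedLoop (hk3 : 2 < k) : (L.toPLPathData ε hk).EmbeddedLoop := by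
  have hedge : ∀ j, (L.toPLPathData ε hk).edge j = L.path ε '' Set.Icc (j : ℝ) (j + 1) :=
    fun _ => rfl
  have hclosed : L.path ε k = L.path ε 0 := L.isLoop ε (hk := hk)
  refine ⟨?_, ?_, ?_, fun h => absurd h hk3.ne', ?_⟩
  · intro j j' hlt hj' hne hcyc
    change j' < k at hj'
    change ¬(j = 0 ∧ j' + 1 = k) at hcyc
    rw [hedge, hedge, Set.eq_empty_iff_forall_notMem]
    rintro _ ⟨⟨t, ht, rfl⟩, t', ht', heq⟩
    rcases L.sep_path ε hlt hj' ht ht' heq.symm with h | h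
    · exact hne h.1
    · exact hcyc ⟨h.1, h.2.1⟩
  · intro j hj hcyc
    change j + 1 < k at hj
    rw [hedge, hedge]
    refine Set.Subset.antisymm ?_ (Set.singleton_subset_iff.mpr
      ⟨⟨_, ⟨by linarith, le_rfl⟩, rfl⟩, _, ⟨?_, ?_⟩, rfl⟩)
    · rintro _ ⟨⟨t, ht, rfl⟩, t', ht', heq⟩
      rcases L.sep_path ε (Nat.lt_succ_self j) hj ht ht' heq.symm with h | h
      · rw [← heq, h.2]
        push_cast
        exact Set.mem_singleton _
      · omega
    · push_cast
      exact le_rfl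
    · push_cast
      linarith
  · intro _
    change (L.toPLPathData ε hk).edge 0 ∩ (L.toPLPathData ε hk).edge (k - 1) = {L.path ε 0}
    have hcast : ((k - 1 : ℕ) : ℝ) + 1 = k := by exact_mod_cast Nat.sub_add_cancel hk
    rw [hedge, hedge]
    refine Set.Subset.antisymm ?_ (Set.singleton_subset_iff.mpr
      ⟨⟨_, ⟨by simp, by simp⟩, rfl⟩, k, ⟨by linarith, hcast.ge⟩, hclosed⟩)
    rintro _ ⟨⟨t, ht, rfl⟩, t', ht', heq⟩
    rcases L.sep_path ε (by omega) (by omega) ht ht' heq.symm with h | h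
    · omega
    · rw [h.2.2, Nat.cast_zero]
      exact Set.mem_singleton _
  · rintro t₁ t₂ t₃ h₁ h₂ h₃ h12 h23 ⟨e12, e23⟩
    change L.path ε t₁ = L.path ε t₂ at e12
    change L.path ε t₂ = L.path ε t₃ at e23
    have hfloor : ∀ t ∈ Set.Ico (0 : ℝ) k, ∃ j < k, t ∈ Set.Ico (j : ℝ) (j + 1) := fun t ht =>
      ⟨⌊t⌋₊, (Nat.floor_lt ht.1).mpr ht.2, Nat.floor_le ht.1, Nat.lt_floor_add_one t⟩
    obtain ⟨j₁, hj₁, m₁⟩ := hfloor t₁ h₁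
    obtain ⟨j₂, hj₂, m₂⟩ := hfloor t₂ h₂
    obtain ⟨j₃, hj₃, m₃⟩ := hfloor t₃ h₃
    have hle : ∀ {t t' : ℝ} {j j' : ℕ}, t < t' → t ∈ Set.Ico (j : ℝ) (j + 1) →
        t' ∈ Set.Ico (j' : ℝ) (j' + 1) → j ≤ j' := fun {t t' j j'} htt ht ht' => by
      have : (j : ℝ) < j' + 1 := ht.1.trans_lt (htt.trans ht'.2)
      exact Nat.lt_succ_iff.mp (by exact_mod_cast this)
    have hIcc : ∀ {t : ℝ} {j : ℕ}, t ∈ Set.Ico (j : ℝ) (j + 1) → t ∈ Set.Icc (j : ℝ) (j + 1) :=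
      fun h => Set.Ico_subset_Icc_self h
    have hsame : ∀ {t t' : ℝ} {j : ℕ}, t ∈ Set.Ico (j : ℝ) (j + 1) → t' ∈ Set.Ico (j : ℝ) (j + 1) →
        L.path ε t = L.path ε t' →
        zigzag (L.τ j) (L.h j) (t - j) = zigzag (L.τ j) (L.h j) (t' - j) :=
      fun ht ht' h => by
        rw [L.path_of_mem ε (hIcc ht), L.path_of_mem ε (hIcc ht')] at h
        exact L.pt_injective ε h
    have hend : ∀ {t t' : ℝ} {j : ℕ}, t ∈ Set.Ico (j : ℝ) (j + 1) → t' ∈ Set.Ico (j : ℝ) (j + 1) →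
        L.path ε t = L.path ε (j + 1) → L.path ε t' = L.path ε (j + 1) → t = t' :=
      fun {t t' j} ht ht' h h' => by
        rw [path_succ, L.path_of_mem ε (hIcc ht)] at h
        rw [path_succ, L.path_of_mem ε (hIcc ht')] at h'
        have := eq_of_zigzag_eq_end (L.τ_pos j) (L.τ_ne j) (by linarith [ht.2])
          (by linarith [ht'.2]) (L.pt_injective ε h) (L.pt_injective ε h')
        linarith
    rcases (hle h12 m₁ m₂).lt_or_eq with l12 | rfl <;>
      rcases (hle h23 m₂ m₃).lt_or_eq with l23 | rfl
    · rcases L.sep_path ε l12 hj₂ (hIcc m₁) (hIcc m₂) e12 with h | h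
      · rcases L.sep_path ε l23 hj₃ (hIcc m₂) (hIcc m₃) e23 with h' | h'
        · rw [h.2, h'.2, h'.1, Nat.cast_succ, path_succ, path_natCast] at e23
          exact (L.h_pos j₂).ne (L.pt_injective ε e23)
        · omega
      · omega
    · rcases L.sep_path ε l12 hj₂ (hIcc m₁) (hIcc m₂) e12 with h | h
      · rcases L.sep_path ε l12 hj₂ (hIcc m₁) (hIcc m₃) (e12.trans e23) with h' | h'
        · linarith [h.2, h'.2]
        · omega
      · have e : L.path ε t₁ = L.path ε (j₂ + 1) := by
          rw [h.2.2, h.1, Nat.cast_zero, ← hclosed]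
          exact congrArg (L.path ε) (by exact_mod_cast h.2.1.symm)
        exact h23.ne (hend m₂ m₃ (e12.symm.trans e) ((e12.trans e23).symm.trans e))
    · rcases L.sep_path ε l23 hj₃ (hIcc m₂) (hIcc m₃) e23 with h | h
      · have e : L.path ε t₃ = L.path ε (j₁ + 1) := by rw [h.2, h.1, Nat.cast_succ]
        exact h12.ne (hend m₁ m₂ ((e12.trans e23).trans e) (e23.trans e))
      · have := m₁.1
        have := h.2.2
        linarith
    · exact not_zigzag_eq_three (L.τ_pos j₁) (L.τ_ne j₁) (by linarith) (by linarith)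
        (hsame m₁ m₂ e12) (hsame m₂ m₃ e23)

end ZigzagLoop

/-- A cyclic list of abscissae with two ascents is the list of the edge directions of a zigzag
loop. -/
theorem exists_zigzagLoop {k a b : ℕ} {x : ℕ → ℝ} (hx : ∀ j, x (j % k) = x j)
    (hne : ∀ j, x j ≠ x (j + 1)) (hab : a < b) (hbk : b < k) (ha : x a < x (a + 1))
    (hb : x b < x (b + 1)) : Nonempty (ZigzagLoop k x) := by
  have hper : ∀ j, x (j + k) = x j := fun j => by rw [← hx (j + k), Nat.add_mod_right, hx]
  obtain ⟨L⟩ := exists_zigzagLoop_of_ascents (k := k) (n := b - a) (x := fun j => x (j + (a + 1)))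
    (fun j => by rw [← hx, Nat.mod_add_mod, hx]) (by omega) (by omega)
    (fun j => by rw [add_right_comm j 1]; exact hne _)
    (by rwa [show b - a - 1 + (a + 1) = b by omega, show b - a + (a + 1) = b + 1 by omega])
    (by rwa [show k - 1 + (a + 1) = a + k by omega, hper, zero_add])
  have e : (fun j => (fun j => x (j + (a + 1))) (j + (k - (a + 1)))) = x := by
    funext j
    dsimp only
    rw [show j + (k - (a + 1)) + (a + 1) = j + k by omega, hper]
  exact ⟨e ▸ L.shift (k - (a + 1))⟩

/-- Any cyclic right polygonal slope list whose positive turning is at least `2π` can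
be realized by an embedded right polygonal loop with folds in the plane. -/
theorem exists_embedded_right_polygonal_loop
    (k : ℕ) (hk : 0 < k) (s : ℕ → Slope)
    (hrp : ∀ j < k, (primDet (s j) (s ((j + 1) % k))).natAbs = 1)
    (hT : 2 * Real.pi ≤ posTurning k s) :
    ∃ P : PLPathData, P.k = k ∧ P.Realizes s ∧ P.RightPolygonalLoopFor s ∧
      P.EmbeddedLoop := by
  obtain ⟨ε, hε, hs⟩ := exists_shearAdmissible k s
  obtain ⟨a, b, hab, hbk, ha, hb⟩ := exists_two_descents hk s hT
  have hlt := fun j => Nat.mod_lt j hk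
  set x : ℕ → ℝ := fun j => shearedSlope ε (s (j % k)) with hxdef
  have hx : ∀ j, x (j % k) = x j := fun j => by simp only [hxdef, Nat.mod_mod]
  have hslope : ∀ j < k, s j ≠ s ((j + 1) % k) := fun j hj h => by
    have := hrp j hj
    rw [← h, primDet, mul_comm, sub_self] at this
    simp at this
  have hne : ∀ j, x j ≠ x (j + 1) := fun j h => by
    refine hslope _ (hlt j) ?_
    rw [Nat.mod_add_mod]
    exact shearedSlope_injOn hε (hs _ (hlt _)) (hs _ (hlt _)) h
  have hasc : ∀ j < k, slopeAngle (s ((j + 1) % k)) < slopeAngle (s j) → x j < x (j + 1) :=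
    fun j hj h => by
      have := shearedSlope_lt_of_slopeAngle_lt hε (hs _ hj) (hs _ (hlt _)) h
      simpa only [hxdef, Nat.mod_eq_of_lt hj] using this
  have ha' := hasc a (hab.trans hbk) ha
  have hb' := hasc b hbk hb
  have hxk : x k = x 0 := by rw [← hx k, Nat.mod_self]
  have hk3 : 2 < k := by
    by_contra! hk2
    obtain ⟨rfl, rfl, rfl⟩ : k = 2 ∧ a = 0 ∧ b = 1 := by omega
    rw [hxk] at hb'
    exact lt_asymm ha' hb'
  obtain ⟨L⟩ := exists_zigzagLoop hx hne hab hbk ha' hb'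
  refine ⟨L.toPLPathData ε hk, rfl, L.realizes ε hε hs (fun j hj => ?_) (fun j hj => ?_),
    L.rightPolygonalLoopFor ε hxk hrp, L.embeddedLoop ε hk3⟩
  · simp only [hxdef, Nat.mod_eq_of_lt hj]
  · have := hslope j (by omega)
    rwa [Nat.mod_eq_of_lt hj] at this
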